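/- arXiv:1003.0429 — 2 statements merged into one kernel-verified Lean document; each statement's English description precedes it below -/
import Mathlib

section
/- Let α_M : (Z₂)ⁿ → Z₂ be defined by α_M(x) = 1 iff the Hamming weight of x is congruent to 1 mod 4, and let β(x,y) = α_M(x+y) + α_M(x) + α_M(y). Let z = (1,...,1). Then β(y,z) = 0 for all y ∈ (Z₂)ⁿ if and only if n ≡ 2 (mod 4). -/
/-- Hamming weight of x ∈ (Z₂)ⁿ. -/
def wt {n : ℕ} (x : Fin n → ZMod 2) : ℕ :=
  (Finset.univ.filter (fun i => x i = 1)).card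

theorem wt_compl {n : ℕ} (y : Fin n → ZMod 2) : wt (y + fun _ => 1) + wt y = n := by
  have h : (Finset.univ.filter (fun i => (y + (fun _ => 1 : Fin n → ZMod 2)) i = 1))
      = Finset.univ.filter (fun i => ¬ y i = 1) := by
    ext i
    simp only [Finset.mem_filter, Finset.mem_univ, true_and, Pi.add_apply]
    generalize y i = a
    revert a
    decide
  unfold wt
  rw [h, add_comm, Finset.card_filter_add_card_filter_not]
  simp

theorem wt_exists {n : ℕ} (k : ℕ) (hk : k ≤ n) : ∃ y : Fin n → ZMod 2, wt y = k := by
  obtain ⟨s, -, hs⟩ := Finset.exists_subset_card_eq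
    (s := (Finset.univ : Finset (Fin n))) (n := k) (by simpa using hk)
  refine ⟨fun i => if i ∈ s then 1 else 0, ?_⟩
  unfold wt
  rw [← hs]
  congr 1
  ext i
  by_cases h : i ∈ s <;> simp [h]

theorem zmod2_sum (a b c : ZMod 2) :
    a + b + c = 0 ↔ ((a = 1 ↔ b = 1) ↔ ¬ c = 1) := by
  revert a b c
  decide

/-- For the generating function α_M of Mₙ (n ≥ 3), the element u_z with
    z = (1,…,1) is central (β(y,z) = 0 for all y) iff n ≡ 2 (mod 4). -/
theorem stmt_11 (n : ℕ) (hn : 3 ≤ n) (α : (Fin n → ZMod 2) → ZMod 2)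
    (hα : ∀ x, α x = 1 ↔ wt x % 4 = 1)
    (z : Fin n → ZMod 2) (hz : z = fun _ => 1) :
    (∀ y : Fin n → ZMod 2, α (y + z) + α y + α z = 0) ↔ n % 4 = 2 := by
  have hwz : wt z = n := by subst hz; simp [wt]
  have hc : ∀ y, wt (y + z) + wt y = n := by subst hz; exact wt_compl
  simp only [zmod2_sum, hα, hwz]
  constructor
  · intro h
    obtain ⟨y1, h1⟩ := wt_exists (n := n) 1 (by omega)
    obtain ⟨y2, h2⟩ := wt_exists (n := n) 2 (by omega)
    have a1 := h y1
    have a2 := h y2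
    have c1 := hc y1
    have c2 := hc y2
    omega
  · intro h y
    have := hc y
    omega
end

section
/- (Hurwitz–Radon identity from Oₙ) Let n ≡ 3 (mod 4) and H_n ⊂ (Z₂)ⁿ as above with |H_n| = ρ(2ⁿ). For real variables (a_x)_{x ∈ (Z₂)ⁿ} and (b_y)_{y ∈ H_n}, define c_x = Σ_{y ∈ H_n} (-1)^{f_O(x+y, y)} a_{x+y} b_y. Then (Σ_{x ∈ (Z₂)ⁿ} a_x²)(Σ_{y ∈ H_n} b_y²) = Σ_{x ∈ (Z₂)ⁿ} c_x². -/
/-- The twisting function of the algebra Oₙ. -/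
def fO (n : ℕ) (x y : Fin n → ZMod 2) : ZMod 2 :=
  (∑ p ∈ Finset.univ.filter
      (fun p : Fin n × Fin n × Fin n => p.1 < p.2.1 ∧ p.2.1 < p.2.2),
    (x p.1 * x p.2.1 * y p.2.2 + x p.1 * y p.2.1 * x p.2.2 + y p.1 * x p.2.1 * x p.2.2))
  + ∑ p ∈ Finset.univ.filter (fun p : Fin n × Fin n => p.1 ≤ p.2), x p.1 * y p.2

/-- Hamming weight of a binary vector. -/
def wtO {n : ℕ} (w : Fin n → ZMod 2) : ℕ := ∑ i, (w i).val

lemma zmod2_cases (t : ZMod 2) : t = 0 ∨ t = 1 := by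
  revert t; decide

lemma wtO_succ {n : ℕ} (w : Fin (n+1) → ZMod 2) :
    wtO w = (w 0).val + wtO (fun i => w i.succ) := by
  simp [wtO, Fin.sum_univ_succ]

lemma sum1_eq {n : ℕ} (w : Fin n → ZMod 2) : (∑ i, w i) = (wtO w : ZMod 2) := by
  simp [wtO]

lemma sum2_eq : ∀ {n : ℕ} (w : Fin n → ZMod 2),
    (∑ i, ∑ j, if i < j then w i * w j else 0) = ((wtO w).choose 2 : ZMod 2)
  | 0, w => by simp [wtO]
  | n+1, w => by
    have ih := sum2_eq (fun i => w i.succ)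
    rw [Fin.sum_univ_succ]
    simp only [Fin.sum_univ_succ, Fin.succ_lt_succ_iff, Fin.succ_pos, Fin.not_lt_zero,
      lt_irrefl, if_true, if_false, zero_add]
    rw [ih, ← Finset.mul_sum, sum1_eq, wtO_succ]
    rcases zmod2_cases (w 0) with h | h
    · simp [h]
    · rw [h, show (1 : ZMod 2).val = 1 from rfl, add_comm 1, Nat.choose_succ_succ' _ 1]
      simp

lemma sum2le_eq : ∀ {n : ℕ} (w : Fin n → ZMod 2),
    (∑ i, ∑ j, if i ≤ j then w i * w j else 0) = ((wtO w + 1).choose 2 : ZMod 2)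
  | 0, w => by simp [wtO]
  | n+1, w => by
    have ih := sum2le_eq (fun i => w i.succ)
    have h0 : ∀ i : Fin n, ¬ (i.succ ≤ 0) := fun i => by simp
    rw [Fin.sum_univ_succ]
    simp only [Fin.sum_univ_succ, Fin.succ_le_succ_iff, Fin.zero_le, h0,
      le_refl, if_true, if_false, zero_add]
    rw [ih, ← Finset.mul_sum, sum1_eq, wtO_succ]
    rcases zmod2_cases (w 0) with h | h
    · simp [h]
    · rw [h, show (1 : ZMod 2).val = 1 from rfl, add_comm 1, Nat.choose_succ_succ' (_ + 1) 1]
      simp; ring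

lemma sum3_eq : ∀ {n : ℕ} (w : Fin n → ZMod 2),
    (∑ i, ∑ j, ∑ k, if i < j ∧ j < k then w i * w j * w k else 0)
      = ((wtO w).choose 3 : ZMod 2)
  | 0, w => by simp [wtO]
  | n+1, w => by
    have ih := sum3_eq (fun i => w i.succ)
    have h2 := sum2_eq (fun i => w i.succ)
    rw [Fin.sum_univ_succ]
    simp only [Fin.sum_univ_succ, Fin.succ_lt_succ_iff, Fin.succ_pos, Fin.not_lt_zero,
      lt_irrefl, if_true, if_false, zero_add, and_false, false_and, true_and,
      Finset.sum_const_zero]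
    have h3 : (∑ i : Fin n, ∑ j : Fin n, if i < j then w 0 * w i.succ * w j.succ else 0)
        = w 0 * ((wtO (fun i => w i.succ)).choose 2 : ZMod 2) := by
      rw [← h2, Finset.mul_sum]
      refine Finset.sum_congr rfl fun i _ => ?_
      rw [Finset.mul_sum]
      refine Finset.sum_congr rfl fun j _ => ?_
      split_ifs <;> ring
    rw [ih, h3, wtO_succ]
    rcases zmod2_cases (w 0) with h | h
    · simp [h]
    · rw [h, show (1 : ZMod 2).val = 1 from rfl, add_comm 1, Nat.choose_succ_succ' _ 2]
      simp

lemma choose_odd (m : ℕ) (hm : m % 4 ≠ 0) :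
    ((m.choose 3 : ℕ) : ZMod 2) + ((m+1).choose 2 : ℕ) = 1 := by
  have key : ∀ q : ℕ, ∀ r : ℕ, ((((4*q+r).choose 3 + (4*q+r+1).choose 2 : ℕ)) : ZMod 2)
      = ((r.choose 3 + (r+1).choose 2 : ℕ) : ZMod 2) := by
    intro q
    induction q with
    | zero => intro r; simp
    | succ q ih =>
      intro r
      have e : 4*(q+1)+r = 4*q+r+4 := by ring
      rw [← ih r, e]
      generalize 4*q+r = s
      have : (s+4).choose 3 + (s+4+1).choose 2
          = (s.choose 3 + (s+1).choose 2) + 2 * (2 * s.choose 2 + 5 * s + 7) := by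
        simp only [Nat.choose_succ_succ' _ 2, Nat.choose_succ_succ' _ 1, Nat.choose_succ_succ' _ 0, zero_add,
          Nat.choose_zero_right, Nat.choose_one_right]
        ring
      rw [this]
      push_cast
      rw [show (2 : ZMod 2) = 0 from rfl]
      ring
  have h := key (m/4) (m%4)
  rw [Nat.div_add_mod] at h
  push_cast at h
  rw [h]
  have : m % 4 = 1 ∨ m % 4 = 2 ∨ m % 4 = 3 := by omega
  rcases this with h | h | h <;> rw [h] <;> decide

lemma fO_add_right (n : ℕ) (u y y' : Fin n → ZMod 2) :
    fO n u (y + y') = fO n u y + fO n u y' := by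
  unfold fO
  have : ∀ A B C D E F : ZMod 2, A = C + E → B = D + F → A + B = C + D + (E + F) := by
    intros; subst_vars; ring
  apply this
  · rw [← Finset.sum_add_distrib]
    refine Finset.sum_congr rfl fun p _ => ?_
    simp only [Pi.add_apply]; ring
  · rw [← Finset.sum_add_distrib]
    refine Finset.sum_congr rfl fun p _ => ?_
    simp only [Pi.add_apply]; ring

lemma fO_shift (n : ℕ) (u w : Fin n → ZMod 2) :
    fO n u w + fO n (u + w) w = ((wtO w).choose 3 : ZMod 2) + ((wtO w + 1).choose 2 : ℕ) := by
  rw [← sum3_eq, ← sum2le_eq]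
  unfold fO
  have : ∀ A B C D E F : ZMod 2, A + C = E → B + D = F → A + B + (C + D) = E + F := by
    intros; subst_vars; ring
  apply this
  · rw [← Finset.sum_add_distrib, Finset.sum_filter, Fintype.sum_prod_type]
    refine Finset.sum_congr rfl fun i _ => ?_
    rw [Fintype.sum_prod_type]
    refine Finset.sum_congr rfl fun j _ => Finset.sum_congr rfl fun k _ => ?_
    simp only [Pi.add_apply]
    split_ifs
    · generalize u i = a, u j = b, u k = c, w i = d, w j = e, w k = f
      revert a b c d e f; decide
    · rfl
  · rw [← Finset.sum_add_distrib, Finset.sum_filter, Fintype.sum_prod_type]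
    refine Finset.sum_congr rfl fun i _ => Finset.sum_congr rfl fun j _ => ?_
    simp only [Pi.add_apply]
    split_ifs
    · generalize u i = a, w i = d, w j = e
      revert a d e; decide
    · rfl

lemma wtO_add_le {n : ℕ} (p q : Fin n → ZMod 2) : wtO (p + q) ≤ wtO p + wtO q := by
  unfold wtO
  rw [← Finset.sum_add_distrib]
  refine Finset.sum_le_sum fun i _ => ?_
  exact ZMod.val_add_le _ _

lemma wtO_compl {n : ℕ} (q : Fin n → ZMod 2) : wtO ((fun _ => 1) + q) + wtO q = n := by
  unfold wtO
  rw [← Finset.sum_add_distrib]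
  have : ∀ t : ZMod 2, (1 + t).val + t.val = 1 := by decide
  simp [this]

lemma wtO_pos {n : ℕ} (q : Fin n → ZMod 2) (h : q ≠ 0) : 0 < wtO q := by
  by_contra h0
  apply h
  have h1 : wtO q = 0 := by omega
  unfold wtO at h1
  rw [Finset.sum_eq_zero_iff] at h1
  funext i
  exact (ZMod.val_eq_zero _).1 (h1 i (Finset.mem_univ i))

lemma wtO_single {n : ℕ} (i : Fin n) : wtO (Pi.single i 1 : Fin n → ZMod 2) = 1 := by
  unfold wtO
  rw [Finset.sum_eq_single i]
  · simp [ZMod.val_one]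
  · intro j _ hj; simp [hj]
  · simp

lemma add_self_O {n : ℕ} (x : Fin n → ZMod 2) : x + x = 0 := by
  funext i; exact CharTwo.add_self_eq_zero _

lemma sq_sum_O {n : ℕ} (H : Finset (Fin n → ZMod 2)) (f : (Fin n → ZMod 2) → (Fin n → ZMod 2) → ZMod 2)
    (a b : (Fin n → ZMod 2) → ℝ)
    (hf : ∀ y ∈ H, ∀ y' ∈ H, y ≠ y' → ∀ x,
      f (x + y) y + f (x + y') y' + (f (x + y') y + f (x + y) y') = 1) :
    (∑ x, (a x) ^ 2) * (∑ y ∈ H, (b y) ^ 2)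
      = ∑ x, (∑ y ∈ H, ((-1 : ℝ) ^ (f (x + y) y).val) * a (x + y) * b y) ^ 2 := by
  simp only [sq (∑ y ∈ H, _), Finset.sum_mul_sum]
  rw [Finset.sum_comm, Finset.sum_comm (s := Finset.univ)]
  refine Finset.sum_congr rfl fun y hy => ?_
  rw [Finset.sum_comm (s := Finset.univ) (t := H)]
  refine Eq.symm ?_
  rw [Finset.sum_eq_single y]
  · rw [← Equiv.sum_comp (Equiv.addRight y) (fun x => a x ^ 2 * b y ^ 2)]
    refine Finset.sum_congr rfl fun x _ => ?_
    have : ((-1 : ℝ) ^ (f (x + y) y).val) * ((-1 : ℝ) ^ (f (x + y) y).val) = 1 := by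
      rw [← mul_pow]; simp
    simp only [Equiv.coe_addRight]
    linear_combination ((a (x+y))^2 * (b y)^2) * this
  · intro y' hy' hne
    have key : ∀ s t s' t' : ZMod 2, s + t + (s' + t') = 1 →
        (-1 : ℝ) ^ s.val * (-1 : ℝ) ^ t.val = - ((-1 : ℝ) ^ s'.val * (-1 : ℝ) ^ t'.val) := by
      intro s t s' t' h
      rcases zmod2_cases s with rfl | rfl <;> rcases zmod2_cases t with rfl | rfl <;>
      rcases zmod2_cases s' with rfl | rfl <;> rcases zmod2_cases t' with rfl | rfl <;>
      first
        | (exfalso; revert h; decide)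
        | simp [ZMod.val_one]
    have hS : ∀ S T : ℝ, S = T → T = -S → S = 0 := by intros; linarith
    refine hS _ _ (Equiv.sum_comp (Equiv.addRight (y + y')) _).symm ?_
    rw [← Finset.sum_neg_distrib]
    refine Finset.sum_congr rfl fun x _ => ?_
    have e1 : x + (y + y') + y = x + y' := by
      rw [show x + (y + y') + y = x + y' + (y + y) by abel, add_self_O, add_zero]
    have e2 : x + (y + y') + y' = x + y := by
      rw [show x + (y + y') + y' = x + y + (y' + y') by abel, add_self_O, add_zero]
    simp only [Equiv.coe_addRight, e1, e2]
    have := key _ _ _ _ (hf y hy y' hy' hne.symm x)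
    linear_combination (a (x+y) * a (x+y') * b y * b y') * this
  · intro h; exact absurd hy h

/-- Hurwitz–Radon identity from Oₙ, for n ≡ 3 (mod 4):
    with Hₙ = {e_i, ē_i : 0 ≤ i ≤ n} and
    c_x = Σ_{y ∈ Hₙ} (-1)^{f_O(x+y,y)} a_{x+y} b_y, one has
    (Σ_x a_x²)(Σ_{y ∈ Hₙ} b_y²) = Σ_x c_x². -/
theorem stmt_19 (n : ℕ) (hn : n % 4 = 3)
    (a b : (Fin n → ZMod 2) → ℝ) :
    let z : Fin n → ZMod 2 := fun _ => 1
    let e : Fin n → (Fin n → ZMod 2) := fun i => Pi.single i 1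
    let H : Finset (Fin n → ZMod 2) :=
      ({0, z} : Finset (Fin n → ZMod 2))
        ∪ Finset.image e Finset.univ
        ∪ Finset.image (fun i => z + e i) Finset.univ
    let c : (Fin n → ZMod 2) → ℝ := fun x =>
      ∑ y ∈ H, ((-1 : ℝ) ^ (fO n (x + y) y).val) * a (x + y) * b y
    (∑ x : Fin n → ZMod 2, (a x) ^ 2) * (∑ y ∈ H, (b y) ^ 2)
      = ∑ x : Fin n → ZMod 2, (c x) ^ 2 := by
  intro z e H c
  have hH : ∀ y ∈ H, ∃ p, wtO p ≤ 1 ∧ (y = p ∨ y = z + p) := by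
    intro y hy
    simp only [H, Finset.mem_union, Finset.mem_insert, Finset.mem_singleton,
      Finset.mem_image, Finset.mem_univ, true_and] at hy
    rcases hy with ((rfl | rfl) | ⟨i, rfl⟩) | ⟨i, rfl⟩
    · exact ⟨0, by simp [wtO], Or.inl rfl⟩
    · exact ⟨0, by simp [wtO], Or.inr (by simp)⟩
    · exact ⟨e i, (wtO_single i).le, Or.inl rfl⟩
    · exact ⟨e i, (wtO_single i).le, Or.inr rfl⟩
  refine sq_sum_O H (fO n) a b ?_
  intro y hy y' hy' hne x
  have hw : wtO (y + y') % 4 ≠ 0 := by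
    have hne0 : y + y' ≠ 0 := by
      intro h
      apply hne
      have h2 := congrArg (· + y') h
      simpa [add_assoc, add_self_O] using h2
    have hpos := wtO_pos _ hne0
    obtain ⟨p, hp, hyp⟩ := hH y hy
    obtain ⟨p', hp', hyp'⟩ := hH y' hy'
    have hle := wtO_add_le p p'
    have hc : wtO (z + (p + p')) + wtO (p + p') = n := wtO_compl (p + p')
    have hcase : y + y' = p + p' ∨ y + y' = z + (p + p') := by
      rcases hyp with rfl | rfl <;> rcases hyp' with rfl | rfl
      · left; rfl
      · right; abel
      · right; abel
      · left
        rw [show z + p + (z + p') = (z + z) + (p + p') by abel, add_self_O, zero_add]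
    rcases hcase with h | h <;> rw [h] at hpos ⊢ <;> omega
  have h1 := fO_shift n (x + y) (y + y')
  have e1 : x + y + (y + y') = x + y' := by
    rw [show x + y + (y + y') = x + y' + (y + y) by abel, add_self_O, add_zero]
  rw [e1, choose_odd _ hw, fO_add_right, fO_add_right] at h1
  rw [← h1]; ring
end
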